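/- Let J be the superalgebra (2,2)₃. A bilinear map h : J × J → J is a supersymmetric 2-cocycle if and only if there exist α, β, γ, δ, ε, λ, θ ∈ F such that h(e₁,e₁) = αe₁ + βe₂, h(e₁,e₂) = γe₁ − βe₂, h(e₁,f₁) = δe₂ + ½αf₁, h(e₁,f₂) = εe₂ + ½αf₂, h(e₂,e₂) = −γe₁ + λe₂, h(e₂,f₁) = −2δe₂ + ½γf₁, h(e₂,f₂) = −2εe₂ + ½γf₂, h(f₁,f₂) = θe₁ + βe₂, h(f₁,f₁) = h(f₂,f₂) = 0, with the remaining basis values determined by supersymmetry (h(e₂,e₁) = h(e₁,e₂), h(fⱼ,eᵢ) = h(eᵢ,fⱼ), h(f₂,f₁) = −h(f₁,f₂)). -/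

import Mathlib

namespace JS22

variable (F : Type*) [Field F] [CharZero F]

/-- The underlying ℤ₂-graded vector space `J = F⁴`: coordinates `0,1` are the even
basis vectors `e₁, e₂` and coordinates `2,3` are the odd basis vectors `f₁, f₂`. -/
abbrev J : Type _ := Fin 4 → F

def e1 : J F := ![1, 0, 0, 0]
def e2 : J F := ![0, 1, 0, 0]
def f1 : J F := ![0, 0, 1, 0]
def f2 : J F := ![0, 0, 0, 1]

/-- The even part `J₀ = span {e₁, e₂}`. -/
def J0 : Submodule F (J F) := Submodule.span F {e1 F, e2 F}

/-- The odd part `J₁ = span {f₁, f₂}`. -/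
def J1 : Submodule F (J F) := Submodule.span F {f1 F, f2 F}

/-- `x` is homogeneous of degree `d ∈ {0, 1}`. -/
def IsHomog (x : J F) (d : ℕ) : Prop :=
  (d = 0 ∧ x ∈ J0 F) ∨ (d = 1 ∧ x ∈ J1 F)

/-- A (bilinear) multiplication is supercommutative: `x y = (−1)^{|x||y|} y x`. -/
def IsSuperComm (mul : J F → J F → J F) : Prop :=
  ∀ x y : J F, ∀ dx dy : ℕ, IsHomog F x dx → IsHomog F y dy →
    mul x y = ((-1 : F) ^ (dx * dy)) • mul y x

/-- The Jordan superidentity, for all homogeneous `w, x, y, z`. -/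
def SatisfiesJordanSuperId (mul : J F → J F → J F) : Prop :=
  ∀ w x y z : J F, ∀ dw dx dy dz : ℕ,
    IsHomog F w dw → IsHomog F x dx → IsHomog F y dy → IsHomog F z dz →
    mul (mul w x) (mul y z)
      + ((-1 : F) ^ (dx * dy)) • mul (mul w y) (mul x z)
      + ((-1 : F) ^ ((dx + dy) * dz)) • mul (mul w z) (mul x y)
      - ((-1 : F) ^ (dw * dx)) • mul x (mul w (mul y z))
      - ((-1 : F) ^ (dy * (dw + dx))) • mul y (mul w (mul x z))
      - ((-1 : F) ^ (dz * (dw + dx + dy))) • mul z (mul w (mul x y)) = 0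

/-- `F(a,b,c,d) = h((ab)c, d) + h(ab,c)·d + (h(a,b)·c)·d`. -/
def Fc (mul : J F → J F → J F) (h : J F →ₗ[F] J F →ₗ[F] J F) (a b c d : J F) : J F :=
  h (mul (mul a b) c) d + mul (h (mul a b) c) d + mul (mul (h a b) c) d

/-- `G(a,b,c,d) = h(ab, cd) + h(a,b)·(cd) + (ab)·h(c,d)`. -/
def Gc (mul : J F → J F → J F) (h : J F →ₗ[F] J F →ₗ[F] J F) (a b c d : J F) : J F :=
  h (mul a b) (mul c d) + mul (h a b) (mul c d) + mul (mul a b) (h c d)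

/-- Supersymmetry of `h`: `h(a,b) = (−1)^{|a||b|} h(b,a)` for homogeneous `a, b`. -/
def IsSuperSym (h : J F →ₗ[F] J F →ₗ[F] J F) : Prop :=
  ∀ a b : J F, ∀ da db : ℕ, IsHomog F a da → IsHomog F b db →
    h a b = ((-1 : F) ^ (da * db)) • h b a

/-- The 2-cocycle identity for `h` with respect to the multiplication `mul`. -/
def IsCocycleId (mul : J F → J F → J F) (h : J F →ₗ[F] J F →ₗ[F] J F) : Prop :=
  ∀ a b c d : J F, ∀ da db dc dd : ℕ,
    IsHomog F a da → IsHomog F b db → IsHomog F c dc → IsHomog F d dd →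
    Fc F mul h a b c d + ((-1 : F) ^ (db * (dc + dd) + dc * dd)) • Fc F mul h a d c b
      + ((-1 : F) ^ (da * (db + dc + dd) + dc * dd)) • Fc F mul h b d c a
    = Gc F mul h a b c d + ((-1 : F) ^ (db * dc)) • Gc F mul h a c b d
      + ((-1 : F) ^ (dd * (dc + db))) • Gc F mul h a d b c

/-- `h` is a supersymmetric 2-cocycle. -/
def IsSuperCocycle (mul : J F → J F → J F) (h : J F →ₗ[F] J F →ₗ[F] J F) : Prop :=
  IsSuperSym F h ∧ IsCocycleId F mul h

/-- `h` is a coboundary: `h(a,b) = a·μ(b) + μ(a)·b − μ(a·b)` for some linear `μ`. -/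
def IsCoboundary (mul : J F → J F → J F) (h : J F →ₗ[F] J F →ₗ[F] J F) : Prop :=
  ∃ μ : J F →ₗ[F] J F, ∀ a b : J F, h a b = mul a (μ b) + mul (μ a) b - μ (mul a b)

/-- The bilinear map `h` is even: `h(J_i × J_j) ⊆ J_{i+j}`. -/
def IsEvenBilin (h : J F →ₗ[F] J F →ₗ[F] J F) : Prop :=
  (∀ a ∈ J0 F, ∀ b ∈ J0 F, h a b ∈ J0 F) ∧
  (∀ a ∈ J0 F, ∀ b ∈ J1 F, h a b ∈ J1 F) ∧
  (∀ a ∈ J1 F, ∀ b ∈ J0 F, h a b ∈ J1 F) ∧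
  (∀ a ∈ J1 F, ∀ b ∈ J1 F, h a b ∈ J0 F)

/-- The linear map `μ` is even: `μ(J_i) ⊆ J_i`. -/
def IsEvenLin (μ : J F →ₗ[F] J F) : Prop :=
  (∀ a ∈ J0 F, μ a ∈ J0 F) ∧ (∀ a ∈ J1 F, μ a ∈ J1 F)

/-- `φ` is a graded algebra isomorphism from `(J, mulA)` onto `(J, mulB)`. -/
def IsGradedIso (mulA mulB : J F → J F → J F) (φ : J F → J F) : Prop :=
  IsLinearMap F φ ∧ Function.Bijective φ ∧
  φ '' (J0 F : Set (J F)) = (J0 F : Set (J F)) ∧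
  φ '' (J1 F : Set (J F)) = (J1 F : Set (J F)) ∧
  ∀ x y : J F, φ (mulA x y) = mulB (φ x) (φ y)

/-- `D_γ`: `e₁²=e₁`, `e₂²=e₂`, `eᵢfⱼ = ½fⱼ`, `f₁f₂ = e₁ + γe₂`. -/
def mulD (γ : F) (x y : J F) : J F :=
  ![x 0 * y 0 + (x 2 * y 3 - x 3 * y 2),
    x 1 * y 1 + γ * (x 2 * y 3 - x 3 * y 2),
    ((x 0 + x 1) * y 2 + x 2 * (y 0 + y 1)) / 2,
    ((x 0 + x 1) * y 3 + x 3 * (y 0 + y 1)) / 2]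

/-- `(2,2)₁`: `e₁²=e₁`, `e₂²=e₂`. -/
def mul1 (x y : J F) : J F :=
  ![x 0 * y 0, x 1 * y 1, 0, 0]

/-- `(2,2)₃`: `e₁²=e₁`, `e₂²=e₂`, `e₁f₁=½f₁`, `e₁f₂=½f₂`, `f₁f₂=e₁`. -/
def mul3 (x y : J F) : J F :=
  ![x 0 * y 0 + (x 2 * y 3 - x 3 * y 2), x 1 * y 1,
    (x 0 * y 2 + x 2 * y 0) / 2, (x 0 * y 3 + x 3 * y 0) / 2]

/-- `(2,2)₅`: `e₁²=e₁`, `e₂²=e₂`, `e₁f₁=f₁`, `e₁f₂=f₂`, `f₁f₂=e₁`. -/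
def mul5 (x y : J F) : J F :=
  ![x 0 * y 0 + (x 2 * y 3 - x 3 * y 2), x 1 * y 1,
    x 0 * y 2 + x 2 * y 0, x 0 * y 3 + x 3 * y 0]

/-- `(2,2)₇`: `e₁²=e₁`, `e₂²=e₂`, `eᵢfⱼ=½fⱼ`, `f₁f₂=e₂`. -/
def mul7 (x y : J F) : J F :=
  ![x 0 * y 0, x 1 * y 1 + (x 2 * y 3 - x 3 * y 2),
    ((x 0 + x 1) * y 2 + x 2 * (y 0 + y 1)) / 2,
    ((x 0 + x 1) * y 3 + x 3 * (y 0 + y 1)) / 2]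

/-- `(2,2)₈`: `e₁²=e₁`, `e₂²=e₂`, `e₁f₁=½f₁`. -/
def mul8 (x y : J F) : J F :=
  ![x 0 * y 0, x 1 * y 1, (x 0 * y 2 + x 2 * y 0) / 2, 0]

/-- `(2,2)₂₆`: `e₁²=e₁`, `e₁f₁=½f₁`, `e₁f₂=½f₂`, `f₁f₂=e₁+e₂`. -/
def mul26 (x y : J F) : J F :=
  ![x 0 * y 0 + (x 2 * y 3 - x 3 * y 2), x 2 * y 3 - x 3 * y 2,
    (x 0 * y 2 + x 2 * y 0) / 2, (x 0 * y 3 + x 3 * y 0) / 2]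

/-- `(2,2)₄₃`: `e₁²=e₁`, `e₁e₂=e₂`, `e₁f₁=f₁`, `e₁f₂=f₂`, `f₁f₂=e₁+e₂`. -/
def mul43 (x y : J F) : J F :=
  ![x 0 * y 0 + (x 2 * y 3 - x 3 * y 2),
    x 0 * y 1 + x 1 * y 0 + (x 2 * y 3 - x 3 * y 2),
    x 0 * y 2 + x 2 * y 0, x 0 * y 3 + x 3 * y 0]

/-- `(2,2)₅₂`: `e₁²=e₁`, `e₁e₂=½e₂`. -/
def mul52 (x y : J F) : J F :=
  ![x 0 * y 0, (x 0 * y 1 + x 1 * y 0) / 2, 0, 0]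

/-- `(2,2)₅₇`: `e₁²=e₁`, `e₁e₂=½e₂`, `e₁f₂=f₂`. -/
def mul57 (x y : J F) : J F :=
  ![x 0 * y 0, (x 0 * y 1 + x 1 * y 0) / 2, 0, x 0 * y 3 + x 3 * y 0]

/-- `(2,2)₆₀`: `e₁²=e₁`, `e₁e₂=½e₂`, `e₁f₁=½f₁`, `e₁f₂=½f₂`. -/
def mul60 (x y : J F) : J F :=
  ![x 0 * y 0, (x 0 * y 1 + x 1 * y 0) / 2,
    (x 0 * y 2 + x 2 * y 0) / 2, (x 0 * y 3 + x 3 * y 0) / 2]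

/-- `(2,2)₆₇`: `e₁²=e₁`, `e₁e₂=½e₂`, `e₁f₁=f₁`, `e₁f₂=f₂`. -/
def mul67 (x y : J F) : J F :=
  ![x 0 * y 0, (x 0 * y 1 + x 1 * y 0) / 2,
    x 0 * y 2 + x 2 * y 0, x 0 * y 3 + x 3 * y 0]


set_option linter.all false
set_option linter.unusedSectionVars false
set_option linter.unusedSimpArgs false

lemma vec_decomp (x : J F) :
    x = x 0 • e1 F + x 1 • e2 F + x 2 • f1 F + x 3 • f2 F := by
  funext k
  fin_cases k <;> simp [e1, e2, f1, f2]

lemma even_form {x : J F} (hx : x ∈ J0 F) : ∃ p q : F, x = ![p, q, 0, 0] := by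
  obtain ⟨p, q, rfl⟩ := Submodule.mem_span_pair.1 hx
  refine ⟨p, q, ?_⟩
  funext k
  fin_cases k <;> simp [e1, e2]

lemma odd_form {x : J F} (hx : x ∈ J1 F) : ∃ p q : F, x = ![0, 0, p, q] := by
  obtain ⟨p, q, rfl⟩ := Submodule.mem_span_pair.1 hx
  refine ⟨p, q, ?_⟩
  funext k
  fin_cases k <;> simp [f1, f2]

lemma hom_e1 : IsHomog F (e1 F) 0 := Or.inl ⟨rfl, Submodule.subset_span (by simp)⟩
lemma hom_e2 : IsHomog F (e2 F) 0 := Or.inl ⟨rfl, Submodule.subset_span (by simp)⟩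
lemma hom_f1 : IsHomog F (f1 F) 1 := Or.inr ⟨rfl, Submodule.subset_span (by simp)⟩
lemma hom_f2 : IsHomog F (f2 F) 1 := Or.inr ⟨rfl, Submodule.subset_span (by simp)⟩

/-- The bilinear map with the parameters of the theorem, in coordinates. -/
def hh (α β γ δ ε lam θ : F) (x y : J F) : J F :=
  ![α * (x 0 * y 0) + γ * (x 0 * y 1 + x 1 * y 0) - γ * (x 1 * y 1)
      + θ * (x 2 * y 3 - x 3 * y 2),
    β * (x 0 * y 0) - β * (x 0 * y 1 + x 1 * y 0) + lam * (x 1 * y 1)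
      + δ * (x 0 * y 2 + x 2 * y 0) + ε * (x 0 * y 3 + x 3 * y 0)
      - 2 * δ * (x 1 * y 2 + x 2 * y 1) - 2 * ε * (x 1 * y 3 + x 3 * y 1)
      + β * (x 2 * y 3 - x 3 * y 2),
    α / 2 * (x 0 * y 2 + x 2 * y 0) + γ / 2 * (x 1 * y 2 + x 2 * y 1),
    α / 2 * (x 0 * y 3 + x 3 * y 0) + γ / 2 * (x 1 * y 3 + x 3 * y 1)]

lemma vec_congr {a b c d a' b' c' d' : F} (h0 : a = a') (h1 : b = b') (h2 : c = c')
    (h3 : d = d') : (![a, b, c, d] : J F) = ![a', b', c', d'] := by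
  rw [h0, h1, h2, h3]

lemma add_vec (a b c d a' b' c' d' : F) :
    (![a, b, c, d] : J F) + ![a', b', c', d'] = ![a + a', b + b', c + c', d + d'] := by
  simp

lemma smul_vec (r a b c d : F) :
    r • (![a, b, c, d] : J F) = ![r * a, r * b, r * c, r * d] := by
  simp

lemma mul3_vec (a b c d a' b' c' d' : F) :
    mul3 F ![a, b, c, d] ![a', b', c', d'] =
      ![a * a' + (c * d' - d * c'), b * b', (a * c' + c * a') / 2, (a * d' + d * a') / 2] := rfl

lemma hh_vec (α β γ δ ε lam θ : F) (x0 x1 x2 x3 y0 y1 y2 y3 : F) :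
    hh F α β γ δ ε lam θ ![x0, x1, x2, x3] ![y0, y1, y2, y3] =
  ![α * (x0 * y0) + γ * (x0 * y1 + x1 * y0) - γ * (x1 * y1)
      + θ * (x2 * y3 - x3 * y2),
    β * (x0 * y0) - β * (x0 * y1 + x1 * y0) + lam * (x1 * y1)
      + δ * (x0 * y2 + x2 * y0) + ε * (x0 * y3 + x3 * y0)
      - 2 * δ * (x1 * y2 + x2 * y1) - 2 * ε * (x1 * y3 + x3 * y1)
      + β * (x2 * y3 - x3 * y2),
    α / 2 * (x0 * y2 + x2 * y0) + γ / 2 * (x1 * y2 + x2 * y1),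
    α / 2 * (x0 * y3 + x3 * y0) + γ / 2 * (x1 * y3 + x3 * y1)] := rfl

lemma hh_sym (α β γ δ ε lam θ : F) (h : J F →ₗ[F] J F →ₗ[F] J F)
    (key : ∀ x y, h x y = hh F α β γ δ ε lam θ x y) : IsSuperSym F h := by
  rintro a b da db ha hb
  rcases ha with ⟨rfl, ha⟩ | ⟨rfl, ha⟩ <;> rcases hb with ⟨rfl, hb⟩ | ⟨rfl, hb⟩
  all_goals
    first
      | obtain ⟨a0, a1, rfl⟩ := even_form F ha
      | obtain ⟨a0, a1, rfl⟩ := odd_form F ha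
    first
      | obtain ⟨b0, b1, rfl⟩ := even_form F hb
      | obtain ⟨b0, b1, rfl⟩ := odd_form F hb
    rw [key, key]
    funext k
    fin_cases k <;> simp [hh] <;> ring

set_option maxHeartbeats 4000000 in
lemma hh_cocycle (α β γ δ ε lam θ : F) (h : J F →ₗ[F] J F →ₗ[F] J F)
    (key : ∀ x y, h x y = hh F α β γ δ ε lam θ x y) : IsCocycleId F (mul3 F) h := by
  rintro a b c d da db dc dd ha hb hc hd
  simp only [Fc, Gc, key]
  rcases ha with ⟨rfl, ha⟩ | ⟨rfl, ha⟩ <;> rcases hb with ⟨rfl, hb⟩ | ⟨rfl, hb⟩ <;>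
    rcases hc with ⟨rfl, hc⟩ | ⟨rfl, hc⟩ <;> rcases hd with ⟨rfl, hd⟩ | ⟨rfl, hd⟩
  all_goals
    first
      | obtain ⟨a0, a1, rfl⟩ := even_form F ha
      | obtain ⟨a0, a1, rfl⟩ := odd_form F ha
    first
      | obtain ⟨b0, b1, rfl⟩ := even_form F hb
      | obtain ⟨b0, b1, rfl⟩ := odd_form F hb
    first
      | obtain ⟨c0, c1, rfl⟩ := even_form F hc
      | obtain ⟨c0, c1, rfl⟩ := odd_form F hc
    first
      | obtain ⟨d0, d1, rfl⟩ := even_form F hd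
      | obtain ⟨d0, d1, rfl⟩ := odd_form F hd
    simp only [hh_vec, mul3_vec, add_vec, smul_vec, mul_zero, zero_mul, add_zero, zero_add, sub_zero,
      zero_sub, zero_div, neg_zero, Nat.mul_zero, Nat.mul_one, Nat.zero_mul, Nat.zero_add, Nat.add_zero, Nat.reduceAdd,
      Nat.reduceMul, pow_zero, pow_one, one_mul]
    apply vec_congr <;> ring

lemma m_e1_e1 : mul3 F (e1 F) (e1 F) = e1 F := by
  funext k; fin_cases k <;> simp [mul3, e1, e2, f1, f2]
lemma m_e1_e2 : mul3 F (e1 F) (e2 F) = 0 := by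
  funext k; fin_cases k <;> simp [mul3, e1, e2, f1, f2]
lemma m_e1_f1 : mul3 F (e1 F) (f1 F) = (1/2 : F) • f1 F := by
  funext k; fin_cases k <;> simp [mul3, e1, e2, f1, f2]
lemma m_e1_f2 : mul3 F (e1 F) (f2 F) = (1/2 : F) • f2 F := by
  funext k; fin_cases k <;> simp [mul3, e1, e2, f1, f2]
lemma m_e2_e1 : mul3 F (e2 F) (e1 F) = 0 := by
  funext k; fin_cases k <;> simp [mul3, e1, e2, f1, f2]
lemma m_e2_e2 : mul3 F (e2 F) (e2 F) = e2 F := by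
  funext k; fin_cases k <;> simp [mul3, e1, e2, f1, f2]
lemma m_e2_f1 : mul3 F (e2 F) (f1 F) = 0 := by
  funext k; fin_cases k <;> simp [mul3, e1, e2, f1, f2]
lemma m_e2_f2 : mul3 F (e2 F) (f2 F) = 0 := by
  funext k; fin_cases k <;> simp [mul3, e1, e2, f1, f2]
lemma m_f1_e1 : mul3 F (f1 F) (e1 F) = (1/2 : F) • f1 F := by
  funext k; fin_cases k <;> simp [mul3, e1, e2, f1, f2]
lemma m_f1_e2 : mul3 F (f1 F) (e2 F) = 0 := by
  funext k; fin_cases k <;> simp [mul3, e1, e2, f1, f2]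
lemma m_f1_f1 : mul3 F (f1 F) (f1 F) = 0 := by
  funext k; fin_cases k <;> simp [mul3, e1, e2, f1, f2]
lemma m_f1_f2 : mul3 F (f1 F) (f2 F) = e1 F := by
  funext k; fin_cases k <;> simp [mul3, e1, e2, f1, f2]
lemma m_f2_e1 : mul3 F (f2 F) (e1 F) = (1/2 : F) • f2 F := by
  funext k; fin_cases k <;> simp [mul3, e1, e2, f1, f2]
lemma m_f2_e2 : mul3 F (f2 F) (e2 F) = 0 := by
  funext k; fin_cases k <;> simp [mul3, e1, e2, f1, f2]
lemma m_f2_f1 : mul3 F (f2 F) (f1 F) = -e1 F := by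
  funext k; fin_cases k <;> simp [mul3, e1, e2, f1, f2]
lemma m_f2_f2 : mul3 F (f2 F) (f2 F) = 0 := by
  funext k; fin_cases k <;> simp [mul3, e1, e2, f1, f2]

lemma m_smul_left (c : F) (x y : J F) : mul3 F (c • x) y = c • mul3 F x y := by
  funext k; fin_cases k <;> simp [mul3] <;> ring
lemma m_smul_right (c : F) (x y : J F) : mul3 F x (c • y) = c • mul3 F x y := by
  funext k; fin_cases k <;> simp [mul3] <;> ring
lemma m_neg_right (x y : J F) : mul3 F x (-y) = - mul3 F x y := by
  funext k; fin_cases k <;> simp [mul3] <;> ring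
lemma m_neg_left (x y : J F) : mul3 F (-x) y = - mul3 F x y := by
  funext k; fin_cases k <;> simp [mul3] <;> ring
lemma m_zero_left (y : J F) : mul3 F 0 y = 0 := by
  funext k; fin_cases k <;> simp [mul3]
lemma m_zero_right (y : J F) : mul3 F y 0 = 0 := by
  funext k; fin_cases k <;> simp [mul3]
lemma r_e1 (x : J F) : mul3 F x (e1 F) = ![x 0, 0, x 2 / 2, x 3 / 2] := by
  funext k; fin_cases k <;> simp [mul3, e1]
lemma r_e2 (x : J F) : mul3 F x (e2 F) = ![0, x 1, 0, 0] := by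
  funext k; fin_cases k <;> simp [mul3, e2]
lemma r_f1 (x : J F) : mul3 F x (f1 F) = ![- x 3, 0, x 0 / 2, 0] := by
  funext k; fin_cases k <;> simp [mul3, f1]
lemma r_f2 (x : J F) : mul3 F x (f2 F) = ![x 2, 0, 0, x 0 / 2] := by
  funext k; fin_cases k <;> simp [mul3, f2]
lemma l_e1 (x : J F) : mul3 F (e1 F) x = ![x 0, 0, x 2 / 2, x 3 / 2] := by
  funext k; fin_cases k <;> simp [mul3, e1]
lemma l_e2 (x : J F) : mul3 F (e2 F) x = ![0, x 1, 0, 0] := by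
  funext k; fin_cases k <;> simp [mul3, e2]
lemma l_f1 (x : J F) : mul3 F (f1 F) x = ![x 3, 0, x 0 / 2, 0] := by
  funext k; fin_cases k <;> simp [mul3, f1]
lemma l_f2 (x : J F) : mul3 F (f2 F) x = ![- x 2, 0, 0, x 0 / 2] := by
  funext k; fin_cases k <;> simp [mul3, f2]
lemma e1_0 : e1 F 0 = 1 := rfl
lemma e1_1 : e1 F 1 = 0 := rfl
lemma e1_2 : e1 F 2 = 0 := rfl
lemma e1_3 : e1 F 3 = 0 := rfl
lemma e2_0 : e2 F 0 = 0 := rfl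
lemma e2_1 : e2 F 1 = 1 := rfl
lemma e2_2 : e2 F 2 = 0 := rfl
lemma e2_3 : e2 F 3 = 0 := rfl
lemma f1_0 : f1 F 0 = 0 := rfl
lemma f1_1 : f1 F 1 = 0 := rfl
lemma f1_2 : f1 F 2 = 1 := rfl
lemma f1_3 : f1 F 3 = 0 := rfl
lemma f2_0 : f2 F 0 = 0 := rfl
lemma f2_1 : f2 F 1 = 0 := rfl
lemma f2_2 : f2 F 2 = 0 := rfl
lemma f2_3 : f2 F 3 = 1 := rfl
/-- description of all supersymmetric 2-cocycles of `(2,2)₃`. -/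
theorem cocycles_of_mul3 (h : J F →ₗ[F] J F →ₗ[F] J F) :
    IsSuperCocycle F (mul3 F) h ↔
    ∃ α β γ δ ε lam θ : F,
      h (e1 F) (e1 F) = α • e1 F + β • e2 F ∧
      h (e1 F) (e2 F) = γ • e1 F - β • e2 F ∧
      h (e1 F) (f1 F) = δ • e2 F + (α / 2) • f1 F ∧
      h (e1 F) (f2 F) = ε • e2 F + (α / 2) • f2 F ∧
      h (e2 F) (e2 F) = (-γ) • e1 F + lam • e2 F ∧
      h (e2 F) (f1 F) = (-(2 * δ)) • e2 F + (γ / 2) • f1 F ∧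
      h (e2 F) (f2 F) = (-(2 * ε)) • e2 F + (γ / 2) • f2 F ∧
      h (f1 F) (f2 F) = θ • e1 F + β • e2 F ∧

      h (f1 F) (f1 F) = 0 ∧ h (f2 F) (f2 F) = 0 ∧
      h (e2 F) (e1 F) = h (e1 F) (e2 F) ∧
      h (f1 F) (e1 F) = h (e1 F) (f1 F) ∧ h (f2 F) (e1 F) = h (e1 F) (f2 F) ∧
      h (f1 F) (e2 F) = h (e2 F) (f1 F) ∧ h (f2 F) (e2 F) = h (e2 F) (f2 F) ∧
      h (f2 F) (f1 F) = - h (f1 F) (f2 F) := by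
  constructor
  · rintro ⟨hs, hc⟩
    have s_e2_e1 := hs _ _ _ _ (hom_e2 F) (hom_e1 F)
    have s_f1_e1 := hs _ _ _ _ (hom_f1 F) (hom_e1 F)
    have s_f2_e1 := hs _ _ _ _ (hom_f2 F) (hom_e1 F)
    have s_f1_e2 := hs _ _ _ _ (hom_f1 F) (hom_e2 F)
    have s_f2_e2 := hs _ _ _ _ (hom_f2 F) (hom_e2 F)
    have s_f2_f1 := hs _ _ _ _ (hom_f2 F) (hom_f1 F)
    have s_f1_f1 := hs _ _ _ _ (hom_f1 F) (hom_f1 F)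
    have s_f2_f2 := hs _ _ _ _ (hom_f2 F) (hom_f2 F)
    simp only [Nat.mul_zero, Nat.mul_one, pow_zero, pow_one, one_smul, neg_smul, Nat.zero_mul] at s_e2_e1 s_f1_e1 s_f2_e1 s_f1_e2 s_f2_e2 s_f2_f1 s_f1_f1 s_f2_f2
    have z1 : h (f1 F) (f1 F) = 0 := self_eq_neg.1 s_f1_f1
    have z2 : h (f2 F) (f2 F) = 0 := self_eq_neg.1 s_f2_f2
    have q_e1_e1_e1_e1 := hc _ _ _ _ _ _ _ _ (hom_e1 F) (hom_e1 F) (hom_e1 F) (hom_e1 F)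
    have q_e1_e1_e1_e2 := hc _ _ _ _ _ _ _ _ (hom_e1 F) (hom_e1 F) (hom_e1 F) (hom_e2 F)
    have q_e1_e1_e1_f1 := hc _ _ _ _ _ _ _ _ (hom_e1 F) (hom_e1 F) (hom_e1 F) (hom_f1 F)
    have q_e1_e1_e1_f2 := hc _ _ _ _ _ _ _ _ (hom_e1 F) (hom_e1 F) (hom_e1 F) (hom_f2 F)
    have q_e1_e1_e2_e2 := hc _ _ _ _ _ _ _ _ (hom_e1 F) (hom_e1 F) (hom_e2 F) (hom_e2 F)
    have q_e1_e1_e2_f1 := hc _ _ _ _ _ _ _ _ (hom_e1 F) (hom_e1 F) (hom_e2 F) (hom_f1 F)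
    have q_e1_e1_e2_f2 := hc _ _ _ _ _ _ _ _ (hom_e1 F) (hom_e1 F) (hom_e2 F) (hom_f2 F)
    have q_e1_e1_f1_e2 := hc _ _ _ _ _ _ _ _ (hom_e1 F) (hom_e1 F) (hom_f1 F) (hom_e2 F)
    have q_e1_e1_f1_f2 := hc _ _ _ _ _ _ _ _ (hom_e1 F) (hom_e1 F) (hom_f1 F) (hom_f2 F)
    have q_e1_e1_f2_e2 := hc _ _ _ _ _ _ _ _ (hom_e1 F) (hom_e1 F) (hom_f2 F) (hom_e2 F)
    have q_e1_e2_e2_f1 := hc _ _ _ _ _ _ _ _ (hom_e1 F) (hom_e2 F) (hom_e2 F) (hom_f1 F)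
    have q_e1_e2_e2_f2 := hc _ _ _ _ _ _ _ _ (hom_e1 F) (hom_e2 F) (hom_e2 F) (hom_f2 F)
    have q_e1_e2_f1_f2 := hc _ _ _ _ _ _ _ _ (hom_e1 F) (hom_e2 F) (hom_f1 F) (hom_f2 F)
    have q_e1_f1_e1_f2 := hc _ _ _ _ _ _ _ _ (hom_e1 F) (hom_f1 F) (hom_e1 F) (hom_f2 F)
    simp only [Fc, Gc, m_e1_e1, m_e1_e2, m_e1_f1, m_e1_f2, m_e2_e1, m_e2_e2, m_e2_f1, m_e2_f2,
      m_f1_e1, m_f1_e2, m_f1_f1, m_f1_f2, m_f2_e1, m_f2_e2, m_f2_f1, m_f2_f2, m_smul_left,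
      m_neg_left, m_smul_right, m_neg_right, m_zero_left, m_zero_right, s_e2_e1, s_f1_e1,
      s_f2_e1, s_f1_e2, s_f2_e2, s_f2_f1, z1, z2, map_smul, map_neg, map_zero,
      LinearMap.smul_apply, LinearMap.neg_apply, LinearMap.zero_apply]
      at q_e1_e1_e1_e1 q_e1_e1_e1_e2 q_e1_e1_e1_f1 q_e1_e1_e1_f2 q_e1_e1_e2_e2 q_e1_e1_e2_f1
        q_e1_e1_e2_f2 q_e1_e1_f1_e2 q_e1_e1_f1_f2 q_e1_e1_f2_e2 q_e1_e2_e2_f1 q_e1_e2_e2_f2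
        q_e1_e2_f1_f2 q_e1_f1_e1_f2
    simp only [l_e1, l_e2, l_f1, l_f2, r_e1, r_e2, r_f1, r_f2]
      at q_e1_e1_e1_e1 q_e1_e1_e1_e2 q_e1_e1_e1_f1 q_e1_e1_e1_f2 q_e1_e1_e2_e2 q_e1_e1_e2_f1
        q_e1_e1_e2_f2 q_e1_e1_f1_e2 q_e1_e1_f1_f2 q_e1_e1_f2_e2 q_e1_e2_e2_f1 q_e1_e2_e2_f2
        q_e1_e2_f1_f2 q_e1_f1_e1_f2
    have q_e1_e1_e1_e1_2 := congrFun q_e1_e1_e1_e1 2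
    have q_e1_e1_e1_e1_3 := congrFun q_e1_e1_e1_e1 3
    have q_e1_e1_e1_e2_1 := congrFun q_e1_e1_e1_e2 1
    have q_e1_e1_e1_f1_2 := congrFun q_e1_e1_e1_f1 2
    have q_e1_e1_e1_f1_3 := congrFun q_e1_e1_e1_f1 3
    have q_e1_e1_e1_f2_2 := congrFun q_e1_e1_e1_f2 2
    have q_e1_e1_e1_f2_3 := congrFun q_e1_e1_e1_f2 3
    have q_e1_e1_e2_e2_0 := congrFun q_e1_e1_e2_e2 0
    have q_e1_e1_e2_e2_2 := congrFun q_e1_e1_e2_e2 2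
    have q_e1_e1_e2_e2_3 := congrFun q_e1_e1_e2_e2 3
    have q_e1_e1_e2_f1_0 := congrFun q_e1_e1_e2_f1 0
    have q_e1_e1_e2_f2_0 := congrFun q_e1_e1_e2_f2 0
    have q_e1_e1_f1_e2_0 := congrFun q_e1_e1_f1_e2 0
    have q_e1_e1_f1_e2_1 := congrFun q_e1_e1_f1_e2 1
    have q_e1_e1_f1_f2_2 := congrFun q_e1_e1_f1_f2 2
    have q_e1_e1_f1_f2_3 := congrFun q_e1_e1_f1_f2 3
    have q_e1_e1_f2_e2_1 := congrFun q_e1_e1_f2_e2 1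
    have q_e1_e2_e2_f1_2 := congrFun q_e1_e2_e2_f1 2
    have q_e1_e2_e2_f1_3 := congrFun q_e1_e2_e2_f1 3
    have q_e1_e2_e2_f2_2 := congrFun q_e1_e2_e2_f2 2
    have q_e1_e2_e2_f2_3 := congrFun q_e1_e2_e2_f2 3
    have q_e1_e2_f1_f2_1 := congrFun q_e1_e2_f1_f2 1
    have q_e1_e2_f1_f2_2 := congrFun q_e1_e2_f1_f2 2
    have q_e1_f1_e1_f2_2 := congrFun q_e1_f1_e1_f2 2
    have q_e1_f1_e1_f2_3 := congrFun q_e1_f1_e1_f2 3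
    simp only [Pi.add_apply, Pi.smul_apply, Pi.neg_apply, Pi.zero_apply, smul_eq_mul,
      Matrix.cons_val]
      at q_e1_e1_e1_e1_2 q_e1_e1_e1_e1_3 q_e1_e1_e1_e2_1 q_e1_e1_e1_f1_2 q_e1_e1_e1_f1_3
        q_e1_e1_e1_f2_2 q_e1_e1_e1_f2_3 q_e1_e1_e2_e2_0 q_e1_e1_e2_e2_2 q_e1_e1_e2_e2_3
        q_e1_e1_e2_f1_0 q_e1_e1_e2_f2_0 q_e1_e1_f1_e2_0 q_e1_e1_f1_e2_1 q_e1_e1_f1_f2_2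
        q_e1_e1_f1_f2_3 q_e1_e1_f2_e2_1 q_e1_e2_e2_f1_2 q_e1_e2_e2_f1_3 q_e1_e2_e2_f2_2
        q_e1_e2_e2_f2_3 q_e1_e2_f1_f2_1 q_e1_e2_f1_f2_2 q_e1_f1_e1_f2_2 q_e1_f1_e1_f2_3
    clear q_e1_e1_e1_e1 q_e1_e1_e1_e2 q_e1_e1_e1_f1 q_e1_e1_e1_f2 q_e1_e1_e2_e2 q_e1_e1_e2_f1
      q_e1_e1_e2_f2 q_e1_e1_f1_e2 q_e1_e1_f1_f2 q_e1_e1_f2_e2 q_e1_e2_e2_f1 q_e1_e2_e2_f2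
      q_e1_e2_f1_f2 q_e1_f1_e1_f2
    refine ⟨h (e1 F) (e1 F) 0, h (e1 F) (e1 F) 1, h (e1 F) (e2 F) 0, h (e1 F) (f1 F) 1,
      h (e1 F) (f2 F) 1, h (e2 F) (e2 F) 1, h (f1 F) (f2 F) 0, ?_, ?_, ?_, ?_, ?_, ?_, ?_, ?_,
      z1, z2, s_e2_e1, s_f1_e1, s_f2_e1, s_f1_e2, s_f2_e2, s_f2_f1⟩
    · funext k
      fin_cases k <;> simp [e1_0, e1_1, e1_2, e1_3, e2_0, e2_1, e2_2, e2_3, f1_0, f1_1, f1_2, f1_3, f2_0, f2_1, f2_2, f2_3]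
      · linear_combination (-4/3) * q_e1_e1_e1_e1_2
      · linear_combination (-4/3) * q_e1_e1_e1_e1_3
    · funext k
      fin_cases k <;> simp [e1_0, e1_1, e1_2, e1_3, e2_0, e2_1, e2_2, e2_3, f1_0, f1_1, f1_2, f1_3, f2_0, f2_1, f2_2, f2_3]
      · linear_combination (1) * q_e1_e1_e1_e2_1
      · linear_combination (1) * q_e1_e1_e2_f2_0
      · linear_combination (-1) * q_e1_e1_e2_f1_0
    · funext k
      fin_cases k <;> simp [e1_0, e1_1, e1_2, e1_3, e2_0, e2_1, e2_2, e2_3, f1_0, f1_1, f1_2, f1_3, f2_0, f2_1, f2_2, f2_3]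
      · linear_combination (2) * q_e1_e1_f1_f2_3 + (-8/3) * q_e1_e1_e1_e1_3
      · linear_combination (-2) * q_e1_e1_e1_f1_2
      · linear_combination (-2) * q_e1_e1_e1_f1_3
    · funext k
      fin_cases k <;> simp [e1_0, e1_1, e1_2, e1_3, e2_0, e2_1, e2_2, e2_3, f1_0, f1_1, f1_2, f1_3, f2_0, f2_1, f2_2, f2_3]
      · linear_combination (-2) * q_e1_e1_f1_f2_2 + (4/3) * q_e1_e1_e1_e1_2
      · linear_combination (-2) * q_e1_e1_e1_f2_2
      · linear_combination (-2) * q_e1_e1_e1_f2_3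
    · funext k
      fin_cases k <;> simp [e1_0, e1_1, e1_2, e1_3, e2_0, e2_1, e2_2, e2_3, f1_0, f1_1, f1_2, f1_3, f2_0, f2_1, f2_2, f2_3]
      · linear_combination (-1) * q_e1_e1_e2_e2_0
      · linear_combination (-2) * q_e1_e1_e2_e2_2 + (-2) * q_e1_e1_e2_f2_0
      · linear_combination (-2) * q_e1_e1_e2_e2_3 + (2) * q_e1_e1_e2_f1_0
    · funext k
      fin_cases k <;> simp [e1_0, e1_1, e1_2, e1_3, e2_0, e2_1, e2_2, e2_3, f1_0, f1_1, f1_2, f1_3, f2_0, f2_1, f2_2, f2_3]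
      · linear_combination (-2) * q_e1_e1_f1_e2_0 + (4) * q_e1_e1_e2_f1_0
      · linear_combination (2) * q_e1_e1_f1_e2_1
      · linear_combination (1/2) * q_e1_e1_e2_e2_0 + (-2) * q_e1_e2_e2_f1_2
      · linear_combination (-2) * q_e1_e2_e2_f1_3
    · funext k
      fin_cases k <;> simp [e1_0, e1_1, e1_2, e1_3, e2_0, e2_1, e2_2, e2_3, f1_0, f1_1, f1_2, f1_3, f2_0, f2_1, f2_2, f2_3]
      · linear_combination (-2) * q_e1_e2_f1_f2_2
      · linear_combination (2) * q_e1_e1_f2_e2_1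
      · linear_combination (-2) * q_e1_e2_e2_f2_2
      · linear_combination (1/2) * q_e1_e1_e2_e2_0 + (-2) * q_e1_e2_e2_f2_3
    · funext k
      fin_cases k <;> simp [e1_0, e1_1, e1_2, e1_3, e2_0, e2_1, e2_2, e2_3, f1_0, f1_1, f1_2, f1_3, f2_0, f2_1, f2_2, f2_3]
      · linear_combination (-1) * q_e1_e1_e1_e2_1 + (2) * q_e1_e2_f1_f2_1
      · linear_combination (-4) * q_e1_f1_e1_f2_2 + (6) * q_e1_e1_f1_f2_2 + (-4) * q_e1_e1_e1_e1_2
      · linear_combination (-4) * q_e1_f1_e1_f2_3 + (6) * q_e1_e1_f1_f2_3 + (-8) * q_e1_e1_e1_e1_3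
  · rintro ⟨α, β, γ, δ, ε, lam, θ, h1, h2, h3, h4, h5, h6, h7, h8, h9, h10, h11, h12, h13, h14,
      h15, h16⟩
    have key : ∀ x y, h x y = hh F α β γ δ ε lam θ x y := by
      intro x y
      conv_lhs => rw [vec_decomp F x, vec_decomp F y]
      simp only [map_add, map_smul, LinearMap.add_apply, LinearMap.smul_apply, h11, h12, h13, h14,
        h15, h16, h1, h2, h3, h4, h5, h6, h7, h8, h9, h10]
      funext k
      fin_cases k <;> simp [hh, e1, e2, f1, f2] <;> ring
    exact ⟨hh_sym F α β γ δ ε lam θ h key, hh_cocycle F α β γ δ ε lam θ h key⟩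

end JS22
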